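/- For every K ≥ 2 there exist n, M and a family of N = 2 real matrices Y₁, Y₂ ∈ ℝ^{n×M} that belongs to S_K^SPLR but not to S_K^JS; that is, rank(Y₁) ≤ K and rank(Y₂) ≤ K, and there is one orthogonal D ∈ ℝ^{n×n} and column-wise K-sparse X₁, X₂ with Yᵢ = D Xᵢ (i = 1, 2), yet there exist no orthogonal D and jointly K-sparse X₁, X₂ with Yᵢ = D Xᵢ for both i. Hence S_K^JS ⊊ S_K^SPLR when N > 1. -/

import Mathlib

open Matrix Finset

/-- `D` is orthogonal (unitary real dictionary): `Dᵀ D = I`. -/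
def IsOrthogonal {n : ℕ} (D : Matrix (Fin n) (Fin n) ℝ) : Prop := Dᵀ * D = 1

/-- A vector is `K`-sparse if it has at most `K` nonzero entries. -/
def KSparseVec {n : ℕ} (K : ℕ) (x : Fin n → ℝ) : Prop :=
  (Finset.univ.filter (fun i => x i ≠ 0)).card ≤ K

/-- A matrix is column-wise `K`-sparse if every column has at most `K` nonzero entries. -/
def ColKSparse {n M : ℕ} (K : ℕ) (X : Matrix (Fin n) (Fin M) ℝ) : Prop :=
  ∀ j : Fin M, KSparseVec K (fun i => X i j)

/-- A matrix is jointly `K`-sparse if it has at most `K` nonzero rows. -/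
def JointKSparse {n M : ℕ} (K : ℕ) (X : Matrix (Fin n) (Fin M) ℝ) : Prop :=
  haveI : DecidablePred (fun i => X i ≠ 0) := fun i =>
    @instDecidableNot (X i = 0) (Fintype.decidablePiFintype (X i) 0)
  (Finset.univ.filter (fun i => X i ≠ 0)).card ≤ K

theorem exists_zero_row {K M : ℕ} (X : Matrix (Fin (K+1)) (Fin M) ℝ) (h : JointKSparse K X) :
    ∃ i, X i = 0 := by
  by_contra hc
  push Not at hc
  unfold JointKSparse at h
  simp [hc] at h

theorem exists_orth_col {K M : ℕ} (D : Matrix (Fin (K+1)) (Fin (K+1)) ℝ)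
    (X Y : Matrix (Fin (K+1)) (Fin M) ℝ) (hD : IsOrthogonal D)
    (h : JointKSparse K X) (hY : Y = D * X) :
    ∃ i, ∀ j, ∑ k, D k i * Y k j = 0 := by
  obtain ⟨i, hi⟩ := exists_zero_row X h
  refine ⟨i, fun j => ?_⟩
  have h1 : Dᵀ * Y = X := by
    rw [hY, ← Matrix.mul_assoc, hD, Matrix.one_mul]
  have h2 := congrFun (congrFun h1 i) j
  rw [hi, Matrix.mul_apply] at h2
  simpa using h2

theorem orth_dot {n : ℕ} (D : Matrix (Fin n) (Fin n) ℝ) (hD : IsOrthogonal D) (i j : Fin n) :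
    ∑ k, D k i * D k j = if i = j then 1 else 0 := by
  have h2 := congrFun (congrFun hD i) j
  rw [Matrix.mul_apply, Matrix.one_apply] at h2
  simpa using h2

/-- strictness of Lemma 8 / Theorem 2(6): for every `K ≥ 2` there is a
family of `N = 2` matrices in `S_K^SPLR` but not in `S_K^JS`; hence `S_K^JS ⊊ S_K^SPLR`
when `N > 1`. -/
theorem SPLR_strictly_larger_than_JS (K : ℕ) (hK : 2 ≤ K) :
    ∃ (n M : ℕ) (Y₁ Y₂ : Matrix (Fin n) (Fin M) ℝ),
      Y₁.rank ≤ K ∧ Y₂.rank ≤ K ∧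
      (∃ (D : Matrix (Fin n) (Fin n) ℝ) (X₁ X₂ : Matrix (Fin n) (Fin M) ℝ),
        IsOrthogonal D ∧ ColKSparse K X₁ ∧ ColKSparse K X₂ ∧
        Y₁ = D * X₁ ∧ Y₂ = D * X₂) ∧
      ¬ (∃ (D : Matrix (Fin n) (Fin n) ℝ) (X₁ X₂ : Matrix (Fin n) (Fin M) ℝ),
          IsOrthogonal D ∧ JointKSparse K X₁ ∧ JointKSparse K X₂ ∧
          Y₁ = D * X₁ ∧ Y₂ = D * X₂) := by
  refine ⟨K + 1, K, Matrix.of fun i j => if i = j.succ then 1 else 0,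
    Matrix.of fun i j => (if i = j.succ then 1 else 0) -
      (if i = 0 then (if j.val = 0 then 1 else 0) else 0), ?_, ?_, ?_, ?_⟩
  · exact Matrix.rank_le_width _
  · exact Matrix.rank_le_width _
  · refine ⟨1, _, _, ?_, ?_, ?_, (Matrix.one_mul _).symm, (Matrix.one_mul _).symm⟩
    · simp [IsOrthogonal]
    · intro j
      refine le_trans (Finset.card_le_card (t := {j.succ, 0}) ?_) (Finset.card_le_two.trans hK)
      intro i hi
      simp at hi
      simp [hi]
    · intro j
      refine le_trans (Finset.card_le_card (t := {j.succ, 0}) ?_) (Finset.card_le_two.trans hK)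
      intro i hi
      by_contra hc
      simp only [Finset.mem_insert, Finset.mem_singleton, not_or] at hc
      have hi2 := (Finset.mem_filter.1 hi).2
      simp [hc.1, hc.2] at hi2
  · rintro ⟨D, X₁, X₂, hD, h1, h2, e1, e2⟩
    obtain ⟨a, ha⟩ := exists_orth_col D X₁ _ hD h1 e1
    obtain ⟨b, hb⟩ := exists_orth_col D X₂ _ hD h2 e2
    simp [mul_sub, Finset.sum_sub_distrib] at ha hb
    have haa := orth_dot D hD a a
    have hbb := orth_dot D hD b b
    have hab := orth_dot D hD a b
    rw [Fin.sum_univ_succ] at haa hbb hab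
    simp [ha] at haa hab
    have ha0 : D 0 a ≠ 0 := by
      intro h
      simp [h] at haa
    have hb0 : D 0 b = 0 := by
      by_cases hEq : a = b
      · subst hEq
        have := hb ⟨0, by omega⟩
        rw [ha] at this
        simp at this
        exact this
      · simp [hEq] at hab
        tauto
    simp [hb0] at hb
    simp [hb0, hb] at hbb
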